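/- If f(x) ≥ 0 for almost every x ∈ D, then the inverse function u_f⁻¹ is concave on V := u_f(D); equivalently, (u_f⁻¹)' is nonincreasing on V. -/

import Mathlib

open MeasureTheory Set intervalIntegral

theorem MeasureTheory.LocallyIntegrableOn.intervalIntegrable_of_mem {D : Set ℝ}
    (hDc : D.OrdConnected) {f : ℝ → ℝ} (hf : LocallyIntegrableOn f D) {a b : ℝ}
    (ha : a ∈ D) (hb : b ∈ D) : IntervalIntegrable f volume a b :=
  (hf.integrableOn_compact_subset (hDc.uIcc_subset ha hb) isCompact_uIcc).intervalIntegrable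

theorem MeasureTheory.LocallyIntegrableOn.continuousOn_primitive {D : Set ℝ} (hD : IsOpen D)
    (hDc : D.OrdConnected) {f : ℝ → ℝ} (hf : LocallyIntegrableOn f D) {α : ℝ} (hα : α ∈ D) :
    ContinuousOn (fun x => ∫ z in α..x, f z) D := by
  intro x hx
  obtain ⟨ε, hε, hball⟩ := Metric.isOpen_iff.1 hD x hx
  have hl : x - ε / 2 ∈ D := hball (by
    rw [Metric.mem_ball, Real.dist_eq, abs_lt]; constructor <;> linarith)
  have hr : x + ε / 2 ∈ D := hball (by
    rw [Metric.mem_ball, Real.dist_eq, abs_lt]; constructor <;> linarith)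
  have hint := hf.intervalIntegrable_of_mem hDc hl hr
  have hcont := continuousOn_primitive_interval' hint (a := x)
    (by rw [uIcc_of_le (by linarith)]; constructor <;> linarith)
  have hnhds : uIcc (x - ε / 2) (x + ε / 2) ∈ nhds x := by
    rw [uIcc_of_le (by linarith)]
    exact Icc_mem_nhds (by linarith) (by linarith)
  have hat : ContinuousAt (fun y => (∫ z in α..x, f z) + ∫ z in x..y, f z) x :=
    continuousAt_const.add (hcont.continuousAt hnhds)
  refine (hat.congr ?_).continuousWithinAt
  filter_upwards [hD.mem_nhds hx] with y hy
  exact integral_add_adjacent_intervals (hf.intervalIntegrable_of_mem hDc hα hx)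
    (hf.intervalIntegrable_of_mem hDc hx hy)

theorem MeasureTheory.LocallyIntegrableOn.monotoneOn_primitive {D : Set ℝ}
    (hDc : D.OrdConnected) {f : ℝ → ℝ} (hf : LocallyIntegrableOn f D) {α : ℝ} (hα : α ∈ D)
    (hpos : ∀ᵐ x ∂(volume.restrict D), 0 ≤ f x) :
    MonotoneOn (fun x => ∫ z in α..x, f z) D := by
  intro x hx y hy hxy
  have hadd := integral_add_adjacent_intervals (hf.intervalIntegrable_of_mem hDc hα hx)
    (hf.intervalIntegrable_of_mem hDc hx hy)
  have hnonneg : 0 ≤ ∫ z in x..y, f z :=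
    integral_nonneg_of_ae_restrict hxy
      (ae_mono (Measure.restrict_mono (hDc.out hx hy) le_rfl) hpos)
  simp only
  linarith

theorem ConvexOn.concaveOn_image_of_leftInvOn {D : Set ℝ} {u v : ℝ → ℝ} (hu : ConvexOn ℝ D u)
    (hmono : StrictMonoOn u D) (himage : Convex ℝ (u '' D)) (hv : LeftInvOn v u D) :
    ConcaveOn ℝ (u '' D) v := by
  refine ⟨himage, ?_⟩
  rintro _ ⟨x, hx, rfl⟩ _ ⟨y, hy, rfl⟩ a b ha hb hab
  obtain ⟨z, hz, hzu⟩ := himage (mem_image_of_mem u hx) (mem_image_of_mem u hy) ha hb hab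
  rw [← hzu, hv hx, hv hy, hv hz]
  refine (hmono.le_iff_le (hu.1 hx hy ha hb hab) hz).1 ?_
  rw [hzu]
  exact hu.2 hx hy ha hb hab

/-- Step in the proof of Proposition 4.4(ii): if `f ≥ 0` a.e. on `D`, then the
inverse `u_f⁻¹` is concave on `V = u_f '' D`; equivalently `(u_f⁻¹)'` is
nonincreasing on `V`. -/
theorem stmt_8 (D : Set ℝ) (hD : IsOpen D) (hDc : D.OrdConnected)
    (f : ℝ → ℝ) (hf : LocallyIntegrableOn f D) (α : ℝ) (hα : α ∈ D)
    (hpos : ∀ᵐ x ∂(volume.restrict D), 0 ≤ f x) :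
    ∀ u : ℝ → ℝ,
      (∀ x, u x = ∫ y in α..x, Real.exp (2 * ∫ z in α..y, f z)) →
      ∃ v : ℝ → ℝ, (∀ x ∈ D, v (u x) = x) ∧ (∀ y ∈ u '' D, u (v y) = y) ∧
        ConcaveOn ℝ (u '' D) v ∧
        AntitoneOn (fun y : ℝ => 1 / Real.exp (2 * ∫ z in α..(v y), f z)) (u '' D) := by
  intro u hu
  obtain rfl : u = fun x => ∫ y in α..x, Real.exp (2 * ∫ z in α..y, f z) := funext hu
  clear hu
  set F : ℝ → ℝ := fun y => Real.exp (2 * ∫ z in α..y, f z)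
  set u : ℝ → ℝ := fun x => ∫ y in α..x, F y
  have hFcont : ContinuousOn F D :=
    (continuousOn_const.mul (hf.continuousOn_primitive hD hDc hα)).rexp
  have hFmono : MonotoneOn F D := fun x hx y hy hxy =>
    Real.exp_le_exp.2 (mul_le_mul_of_nonneg_left
      (hf.monotoneOn_primitive hDc hα hpos hx hy hxy) zero_le_two)
  have hderiv : ∀ x ∈ D, HasDerivAt u (F x) x := fun x hx =>
    integral_hasDerivAt_right
      ((hFcont.mono (hDc.uIcc_subset hα hx)).intervalIntegrable)
      (hFcont.stronglyMeasurableAtFilter hD x hx) (hFcont.continuousAt (hD.mem_nhds hx))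
  have hDconv : Convex ℝ D := hDc.convex
  have hucont : ContinuousOn u D := fun x hx => (hderiv x hx).continuousAt.continuousWithinAt
  have humono : StrictMonoOn u D := strictMonoOn_of_deriv_pos hDconv hucont fun x hx => by
    rw [(hderiv x (interior_subset hx)).deriv]
    exact Real.exp_pos _
  have huconv : ConvexOn ℝ D u := by
    refine MonotoneOn.convexOn_of_deriv hDconv hucont
      (fun x hx => (hderiv x (interior_subset hx)).differentiableAt.differentiableWithinAt) ?_
    rw [hD.interior_eq]
    exact hFmono.congr fun x hx => (hderiv x hx).deriv.symm
  have himage : Convex ℝ (u '' D) :=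
    (hDc.isPreconnected.image u hucont).ordConnected.convex
  have hleft : LeftInvOn (Function.invFunOn u D) u D := humono.injOn.leftInvOn_invFunOn
  refine ⟨Function.invFunOn u D, hleft, ?_,
    huconv.concaveOn_image_of_leftInvOn humono himage hleft, ?_⟩
  · rintro _ ⟨x, hx, rfl⟩
    rw [hleft hx]
  · rintro _ ⟨x, hx, rfl⟩ _ ⟨y, hy, rfl⟩ hxy
    simp only [hleft hx, hleft hy]
    exact one_div_le_one_div_of_le (Real.exp_pos _)
      (hFmono hx hy ((humono.le_iff_le hx hy).1 hxy))
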